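/- Let 1 ≤ N ≤ 9 and let ω₁, ω₂ : ℝ^N → ℝ be smooth positive functions such that: ω₂ is bounded on ℝ^N; there is a constant C > 0 with ω₁(x) ≤ C ω₂(x) for all x with |x| sufficiently large; and ∇ω₁(x) · x ≤ 0 for all x with |x| sufficiently large. Then there is no stable sub-solution of the equation −div(ω₁ ∇u) = ω₂ e^u in ℝ^N. -/

import Mathlib

open MeasureTheory Filter Real
open scoped RealInnerProductSpace

noncomputable def vdiv {N : ℕ} (V : EuclideanSpace ℝ (Fin N) → EuclideanSpace ℝ (Fin N))
    (x : EuclideanSpace ℝ (Fin N)) : ℝ :=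
  LinearMap.trace ℝ (EuclideanSpace ℝ (Fin N)) (fderiv ℝ V x).toLinearMap

def annulus (N : ℕ) (R : ℝ) : Set (EuclideanSpace ℝ (Fin N)) :=
  {x | R < ‖x‖ ∧ ‖x‖ < 2 * R}

section Gradient

variable {E : Type*} [NormedAddCommGroup E] [InnerProductSpace ℝ E] [CompleteSpace E]

lemma inner_gradient_eq_fderiv (f : E → ℝ) (x v : E) : ⟪gradient f x, v⟫ = fderiv ℝ f x v := by
  simp [gradient]

lemma norm_gradient_eq_norm_fderiv (f : E → ℝ) (x : E) : ‖gradient f x‖ = ‖fderiv ℝ f x‖ := by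
  simp [gradient]

lemma ContDiff.gradient_of_two {f : E → ℝ} (hf : ContDiff ℝ 2 f) : ContDiff ℝ 1 (gradient f) :=
  (InnerProductSpace.toDual ℝ E).symm.contDiff.comp
    (hf.fderiv_right (m := 1) (by norm_num))

lemma gradient_mul {f g : E → ℝ} {x : E} (hf : DifferentiableAt ℝ f x)
    (hg : DifferentiableAt ℝ g x) :
    gradient (fun y => f y * g y) x = f x • gradient g x + g x • gradient f x := by
  simp only [gradient]
  rw [fderiv_fun_mul hf hg]
  simp

lemma gradient_exp_mul {u : E → ℝ} {x : E} (a : ℝ) (hu : DifferentiableAt ℝ u x) :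
    gradient (fun y => Real.exp (a * u y)) x = (a * Real.exp (a * u x)) • gradient u x := by
  simp only [gradient]
  rw [fderiv_exp (hu.const_mul a), fderiv_const_mul hu]
  simp [smul_smul, mul_comm]

lemma gradient_pow {f : E → ℝ} {x : E} (n : ℕ) (hf : DifferentiableAt ℝ f x) :
    gradient (fun y => f y ^ n) x = (n * f x ^ (n - 1)) • gradient f x := by
  simp only [gradient]
  rw [fderiv_fun_pow n hf]
  simp

lemma HasCompactSupport.gradient_real {f : E → ℝ} (hf : HasCompactSupport f) :
    HasCompactSupport (gradient f) :=
  (hf.fderiv (𝕜 := ℝ)).comp_left (g := (InnerProductSpace.toDual ℝ E).symm) (map_zero _)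

/-- Scaled smooth cut-off functions, with the natural decay of their gradients. -/
lemma exists_cutoff_family [FiniteDimensional ℝ E] :
    ∃ K : ℝ, ∀ R : ℝ, 0 < R → ∃ η : E → ℝ, ContDiff ℝ 2 η ∧ HasCompactSupport η ∧
      (∀ x, 0 ≤ η x) ∧ (∀ x, η x ≤ 1) ∧ (∀ x, ‖x‖ ≤ R → η x = 1) ∧
      (∀ x, ‖x‖ < R → gradient η x = 0) ∧ (∀ x, 2 * R < ‖x‖ → gradient η x = 0) ∧
      ∀ x, ‖gradient η x‖ ≤ K / R := by
  let b : ContDiffBump (0 : E) := ⟨1, 2, one_pos, one_lt_two⟩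
  have hb : ContDiff ℝ 2 (b : E → ℝ) := b.contDiff
  obtain ⟨K, hK⟩ := (hb.continuous_fderiv (by norm_num)).bounded_above_of_compact_support
    (b.hasCompactSupport.fderiv (𝕜 := ℝ))
  refine ⟨K, fun R hR => ?_⟩
  have hnorm : ∀ x : E, ‖R⁻¹ • x‖ = ‖x‖ / R := fun x => by
    rw [norm_smul, norm_inv, Real.norm_of_nonneg hR.le]; ring
  have hone : ∀ x : E, ‖x‖ ≤ R → b (R⁻¹ • x) = 1 := fun x hx => by
    apply b.one_of_mem_closedBall
    rw [mem_closedBall_zero_iff, hnorm]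
    exact (div_le_one hR).2 hx
  refine ⟨fun x => b (R⁻¹ • x), hb.comp (contDiff_const_smul _),
    b.hasCompactSupport.comp_smul (inv_ne_zero hR.ne'), fun x => b.nonneg, fun x => b.le_one,
    hone, fun x hx => ?_, fun x hx => ?_, fun x => ?_⟩
  · have : (fun x => b (R⁻¹ • x)) =ᶠ[nhds x] fun _ => (1 : ℝ) := by
      filter_upwards [(isOpen_lt continuous_norm continuous_const).mem_nhds hx] with y hy
      exact hone y (le_of_lt hy)
    simp [gradient, this.fderiv_eq]
  · have : (fun x => b (R⁻¹ • x)) =ᶠ[nhds x] fun _ => (0 : ℝ) := by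
      filter_upwards [(isOpen_lt continuous_const continuous_norm).mem_nhds hx] with y hy
      apply b.zero_of_le_dist
      rw [dist_zero_right, hnorm, le_div_iff₀ hR]
      exact le_of_lt hy
    simp [gradient, this.fderiv_eq]
  · rw [norm_gradient_eq_norm_fderiv, fderiv_comp_smul, norm_smul, norm_inv,
      Real.norm_of_nonneg hR.le, div_eq_inv_mul]
    gcongr
    exact hK _

end Gradient

section Divergence

variable {N : ℕ}

lemma vdiv_eq_sum (V : EuclideanSpace ℝ (Fin N) → EuclideanSpace ℝ (Fin N))
    (x : EuclideanSpace ℝ (Fin N)) :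
    vdiv V x = ∑ i, ⟪EuclideanSpace.basisFun (Fin N) ℝ i,
      fderiv ℝ V x (EuclideanSpace.basisFun (Fin N) ℝ i)⟫ := by
  rw [vdiv, LinearMap.trace_eq_sum_inner _ (EuclideanSpace.basisFun (Fin N) ℝ)]
  rfl

lemma continuous_vdiv {V : EuclideanSpace ℝ (Fin N) → EuclideanSpace ℝ (Fin N)}
    (hV : ContDiff ℝ 1 V) : Continuous (vdiv V) := by
  have : vdiv V = fun x => _ := funext (vdiv_eq_sum V)
  rw [this]
  have := hV.continuous_fderiv (by norm_num)
  fun_prop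

/-- Integration by parts against a compactly supported function. -/
lemma integral_vdiv_mul {V : EuclideanSpace ℝ (Fin N) → EuclideanSpace ℝ (Fin N)}
    (hV : ContDiff ℝ 1 V) {φ : EuclideanSpace ℝ (Fin N) → ℝ} (hφ : ContDiff ℝ 1 φ)
    (hφc : HasCompactSupport φ) :
    ∫ x, vdiv V x * φ x = - ∫ x, ⟪gradient φ x, V x⟫ := by
  set b := EuclideanSpace.basisFun (Fin N) ℝ
  have hVd : Differentiable ℝ V := hV.differentiable (by norm_num)
  have hV' := hV.continuous_fderiv (by norm_num)
  have hφ' := hφ.continuous_fderiv (by norm_num)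
  have hVc := hV.continuous
  have hφcont := hφ.continuous
  have hfd : ∀ i x, fderiv ℝ (fun y => ⟪b i, V y⟫) x (b i) = ⟪b i, fderiv ℝ V x (b i)⟫ := by
    intro i x
    rw [fderiv_inner_apply ℝ (differentiableAt_const _) (hVd x)]
    simp
  have hd1 : ∀ i, Integrable (fun x => ⟪b i, fderiv ℝ V x (b i)⟫ * φ x) := fun i =>
    Continuous.integrable_of_hasCompactSupport (by fun_prop) hφc.mul_left
  have hd2 : ∀ i, Integrable (fun x => ⟪b i, V x⟫ * fderiv ℝ φ x (b i)) := fun i =>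
    Continuous.integrable_of_hasCompactSupport (by fun_prop)
      (hφc.fderiv_apply (𝕜 := ℝ) (b i)).mul_left
  have key : ∀ i, ∫ x, ⟪b i, V x⟫ * fderiv ℝ φ x (b i) =
      - ∫ x, ⟪b i, fderiv ℝ V x (b i)⟫ * φ x := by
    intro i
    have := integral_mul_fderiv_eq_neg_fderiv_mul_of_integrable (μ := volume)
      (f := fun y => ⟪b i, V y⟫) (g := φ) (v := b i)
      (by simpa only [hfd] using hd1 i) (hd2 i)
      (Continuous.integrable_of_hasCompactSupport (by fun_prop) hφc.mul_left)
      (fun x _ => (differentiableAt_const _).inner ℝ (hVd x))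
      (fun x _ => hφ.differentiable (by norm_num) x)
    simpa only [hfd] using this
  have h1 : ∀ x, ⟪gradient φ x, V x⟫ = ∑ i, ⟪b i, V x⟫ * fderiv ℝ φ x (b i) := by
    intro x
    rw [inner_gradient_eq_fderiv]
    conv_lhs => rw [← b.sum_repr' (V x)]
    simp
  simp only [h1, vdiv_eq_sum, Finset.sum_mul]
  rw [integral_finsetSum _ fun i _ => hd1 i, integral_finsetSum _ fun i _ => hd2 i,
    ← Finset.sum_neg_distrib]
  exact Finset.sum_congr rfl fun i _ => by rw [key i, neg_neg]

end Divergence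

section Estimates

variable {N : ℕ} {ω₁ ω₂ u : EuclideanSpace ℝ (Fin N) → ℝ}

/-- The energy estimate obtained by testing stability with `exp (15 u / 8) φ` and the differential
inequality with `exp (15 u / 4) φ ^ 2`. -/
lemma stable_energy_estimate (hω₁ : ContDiff ℝ 2 ω₁) (hω₂ : Continuous ω₂)
    (hω₁pos : ∀ x, 0 < ω₁ x) (hu : ContDiff ℝ 2 u)
    (hsub : ∀ x, -vdiv (fun y => ω₁ y • gradient u y) x ≤ ω₂ x * Real.exp (u x))
    (hstab : ∀ ψ : EuclideanSpace ℝ (Fin N) → ℝ, ContDiff ℝ 2 ψ → HasCompactSupport ψ →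
      ∫ x, ω₂ x * Real.exp (u x) * ψ x ^ 2 ≤ ∫ x, ω₁ x * ‖gradient ψ x‖ ^ 2)
    {φ : EuclideanSpace ℝ (Fin N) → ℝ} (hφ : ContDiff ℝ 2 φ) (hφc : HasCompactSupport φ) :
    ∫ x, ω₂ x * Real.exp (19 / 4 * u x) * φ x ^ 2 ≤
      400 * ∫ x, ω₁ x * Real.exp (15 / 4 * u x) * ‖gradient φ x‖ ^ 2 := by
  have hud : Differentiable ℝ u := hu.differentiable (by norm_num)
  have hφd : Differentiable ℝ φ := hφ.differentiable (by norm_num)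
  have hgu : ContDiff ℝ 1 (gradient u) := hu.gradient_of_two
  have hguc := hgu.continuous
  have hgφ : Continuous (gradient φ) := hφ.gradient_of_two.continuous
  have hω₁c := hω₁.continuous
  have huc := hu.continuous
  have hφcont := hφ.continuous
  have hφ2c : HasCompactSupport (fun x => φ x ^ 2) :=
    hφc.comp_left (g := fun t : ℝ => t ^ 2) (by norm_num)
  have hgφ2c : HasCompactSupport (fun x => ‖gradient φ x‖ ^ 2) :=
    hφc.gradient_real.comp_left (g := fun t => ‖t‖ ^ 2) (by simp)
  set A := ∫ x, ω₁ x * Real.exp (15 / 4 * u x) * ‖gradient u x‖ ^ 2 * φ x ^ 2 with hA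
  set I := ∫ x, ω₁ x * Real.exp (15 / 4 * u x) * ⟪gradient u x, gradient φ x⟫ * φ x with hI
  set J := ∫ x, ω₁ x * Real.exp (15 / 4 * u x) * ‖gradient φ x‖ ^ 2 with hJ
  set X := ∫ x, ω₂ x * Real.exp (19 / 4 * u x) * φ x ^ 2 with hX
  have iA : Integrable
      (fun x => ω₁ x * Real.exp (15 / 4 * u x) * ‖gradient u x‖ ^ 2 * φ x ^ 2) :=
    Continuous.integrable_of_hasCompactSupport (by fun_prop) hφ2c.mul_left
  have iI : Integrable
      (fun x => ω₁ x * Real.exp (15 / 4 * u x) * ⟪gradient u x, gradient φ x⟫ * φ x) :=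
    Continuous.integrable_of_hasCompactSupport (by fun_prop) hφc.mul_left
  have iJ : Integrable (fun x => ω₁ x * Real.exp (15 / 4 * u x) * ‖gradient φ x‖ ^ 2) :=
    Continuous.integrable_of_hasCompactSupport (by fun_prop) hgφ2c.mul_left
  have iX : Integrable (fun x => ω₂ x * Real.exp (19 / 4 * u x) * φ x ^ 2) :=
    Continuous.integrable_of_hasCompactSupport (by fun_prop) hφ2c.mul_left
  have stability : X ≤ 225 / 64 * A + 15 / 4 * I + J := by
    have h := hstab (fun x => Real.exp (15 / 8 * u x) * φ x) (by fun_prop) hφc.mul_left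
    have e1 : ∀ x, ω₂ x * Real.exp (u x) * (Real.exp (15 / 8 * u x) * φ x) ^ 2 =
        ω₂ x * Real.exp (19 / 4 * u x) * φ x ^ 2 := by
      intro x
      have : Real.exp (19 / 4 * u x) = Real.exp (u x) * Real.exp (15 / 8 * u x) ^ 2 := by
        rw [← Real.exp_nat_mul, ← Real.exp_add]; congr 1; push_cast; ring
      rw [this]; ring
    have e2 : ∀ x, ω₁ x * ‖gradient (fun x => Real.exp (15 / 8 * u x) * φ x) x‖ ^ 2 =
        225 / 64 * (ω₁ x * Real.exp (15 / 4 * u x) * ‖gradient u x‖ ^ 2 * φ x ^ 2) +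
        15 / 4 * (ω₁ x * Real.exp (15 / 4 * u x) * ⟪gradient u x, gradient φ x⟫ * φ x) +
        ω₁ x * Real.exp (15 / 4 * u x) * ‖gradient φ x‖ ^ 2 := by
      intro x
      have hexp : Real.exp (15 / 4 * u x) = Real.exp (15 / 8 * u x) ^ 2 := by
        rw [← Real.exp_nat_mul]; congr 1; push_cast; ring
      rw [gradient_mul ((hud x).const_mul _).exp (hφd x), gradient_exp_mul _ (hud x),
        norm_add_sq_real, smul_smul, norm_smul, norm_smul, real_inner_smul_left,
        real_inner_smul_right, mul_pow, mul_pow, Real.norm_eq_abs, Real.norm_eq_abs, sq_abs,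
        sq_abs, hexp, real_inner_comm (gradient u x)]
      ring
    simp only [e1, e2] at h
    refine h.trans_eq ((integral_add ((iA.const_mul _).add (iI.const_mul _)) iJ).trans ?_)
    simp only [Pi.add_apply]
    rw [integral_add (iA.const_mul _) (iI.const_mul _), integral_const_mul, integral_const_mul]
  have subsolution : 15 / 4 * A + 2 * I ≤ X := by
    have hV : ContDiff ℝ 1 (fun y => ω₁ y • gradient u y) := (hω₁.of_le (by norm_num)).smul hgu
    have hh : ContDiff ℝ 2 (fun x => Real.exp (15 / 4 * u x) * φ x ^ 2) := by fun_prop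
    have h := integral_vdiv_mul hV (hh.of_le (by norm_num)) hφ2c.mul_left
    have e : ∀ x, ⟪gradient (fun x => Real.exp (15 / 4 * u x) * φ x ^ 2) x,
        ω₁ x • gradient u x⟫ =
        15 / 4 * (ω₁ x * Real.exp (15 / 4 * u x) * ‖gradient u x‖ ^ 2 * φ x ^ 2) +
        2 * (ω₁ x * Real.exp (15 / 4 * u x) * ⟪gradient u x, gradient φ x⟫ * φ x) := by
      intro x
      rw [gradient_mul ((hud x).const_mul _).exp ((hφd x).fun_pow 2), gradient_exp_mul _ (hud x),
        gradient_pow 2 (hφd x), inner_add_left]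
      simp only [real_inner_smul_left, real_inner_smul_right, real_inner_self_eq_norm_sq]
      rw [real_inner_comm (gradient u x)]
      push_cast
      ring
    simp only [e] at h
    rw [integral_add (iA.const_mul _) (iI.const_mul _), integral_const_mul,
      integral_const_mul] at h
    have hle : -(∫ x, vdiv (fun y => ω₁ y • gradient u y) x *
        (Real.exp (15 / 4 * u x) * φ x ^ 2)) ≤ X := by
      rw [← integral_neg]
      have hdiv := continuous_vdiv hV
      refine integral_mono (Continuous.integrable_of_hasCompactSupport (by fun_prop)
        hφ2c.mul_left.mul_left).neg iX fun x => ?_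
      have hx := mul_le_mul_of_nonneg_right (hsub x)
        (show 0 ≤ Real.exp (15 / 4 * u x) * φ x ^ 2 by positivity)
      have : Real.exp (19 / 4 * u x) = Real.exp (u x) * Real.exp (15 / 4 * u x) := by
        rw [← Real.exp_add]; congr 1; ring
      simp only [this]
      linarith
    linarith
  have young : ∀ s : ℝ, 0 < s → ∀ σ : ℝ, σ ^ 2 = 1 → σ * (2 * I) ≤ s * A + s⁻¹ * J := by
    intro s hs σ hσ
    rw [hI, hA, hJ, ← integral_const_mul, ← integral_const_mul, ← integral_const_mul,
      ← integral_const_mul, ← integral_add (iA.const_mul _) (iJ.const_mul _)]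
    refine integral_mono ((iI.const_mul _).const_mul _)
      ((iA.const_mul _).add (iJ.const_mul _)) fun x => ?_
    have hn : 0 ≤ ‖(s * φ x) • gradient u x - σ • gradient φ x‖ ^ 2 := by positivity
    rw [norm_sub_sq_real, norm_smul, norm_smul, real_inner_smul_left,
      real_inner_smul_right, mul_pow, mul_pow, Real.norm_eq_abs, Real.norm_eq_abs, sq_abs,
      sq_abs, hσ] at hn
    have hw : 0 ≤ ω₁ x * Real.exp (15 / 4 * u x) * s⁻¹ := by
      have := hω₁pos x
      positivity
    have hm := mul_nonneg hw hn
    rw [← sub_nonneg]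
    refine hm.trans_eq ?_
    field_simp
    ring
  have y1 := young 1 one_pos (-1) (by norm_num)
  have y2 := young (1 / 15) (by norm_num) 1 (by norm_num)
  norm_num at y1 y2
  linarith

/-- The pointwise Young inequality that absorbs the gradient of the cut-off. -/
lemma pointwise_absorption {z η r e : ℝ} (hz : 0 ≤ z) (hη : 0 ≤ η) (hη1 : η ≤ 1) (hr : 0 ≤ r)
    (he : 0 < e) : z ^ 15 * η ^ 8 * r ^ 4 ≤ e ^ 4 * (z ^ 19 * η ^ 10) + r ^ 19 / e ^ 15 := by
  rcases le_total (r ^ 4) (e ^ 4 * (z ^ 4 * η ^ 2)) with h | h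
  · have h1 : z ^ 15 * η ^ 8 * r ^ 4 ≤ z ^ 15 * η ^ 8 * (e ^ 4 * (z ^ 4 * η ^ 2)) := by gcongr
    have h2 : 0 ≤ r ^ 19 / e ^ 15 := by positivity
    linarith
  · have h1 : e ^ 15 * (z ^ 15 * η ^ 8) ≤ r ^ 15 := by
      refine le_of_pow_le_pow_left₀ (n := 4) (by norm_num) (by positivity) ?_
      calc (e ^ 15 * (z ^ 15 * η ^ 8)) ^ 4 = (e ^ 4 * (z ^ 4 * η ^ 2)) ^ 15 * η ^ 2 := by ring
        _ ≤ (r ^ 4) ^ 15 * 1 := by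
          gcongr
          exact pow_le_one₀ hη hη1
        _ = (r ^ 15) ^ 4 := by ring
    have h2 : z ^ 15 * η ^ 8 * r ^ 4 ≤ r ^ 19 / e ^ 15 := by
      rw [le_div_iff₀ (by positivity)]
      have := mul_le_mul_of_nonneg_right h1 (show 0 ≤ r ^ 4 by positivity)
      nlinarith
    have h3 : 0 ≤ e ^ 4 * (z ^ 19 * η ^ 10) := by positivity
    linarith

lemma setIntegral_closedBall_pos {f : EuclideanSpace ℝ (Fin N) → ℝ} (hf : Continuous f)
    (hpos : ∀ x, 0 < f x) : 0 < ∫ x in Metric.closedBall 0 1, f x := by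
  rw [setIntegral_pos_iff_support_of_nonneg_ae (Eventually.of_forall fun x => (hpos x).le)
    (hf.continuousOn.integrableOn_compact (isCompact_closedBall 0 1))]
  have : Function.support f = Set.univ := Set.eq_univ_of_forall fun x => (hpos x).ne'
  rw [this, Set.univ_inter]
  exact Metric.measure_closedBall_pos _ _ one_pos

/-- The decay of the weighted exponential integral over the unit ball, as the cut-off radius
`S ^ 2` grows. -/
lemma stable_integral_decay (hN9 : N ≤ 9) (hω₁ : ContDiff ℝ 2 ω₁) (hω₂ : Continuous ω₂)
    (hω₁pos : ∀ x, 0 < ω₁ x) (hω₂pos : ∀ x, 0 < ω₂ x) {M C R₀ : ℝ} (hM : ∀ x, ω₂ x ≤ M)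
    (hC : 0 < C) (hcomp : ∀ x, R₀ ≤ ‖x‖ → ω₁ x ≤ C * ω₂ x) (hu : ContDiff ℝ 2 u)
    (hsub : ∀ x, -vdiv (fun y => ω₁ y • gradient u y) x ≤ ω₂ x * Real.exp (u x))
    (hstab : ∀ ψ : EuclideanSpace ℝ (Fin N) → ℝ, ContDiff ℝ 2 ψ → HasCompactSupport ψ →
      ∫ x, ω₂ x * Real.exp (u x) * ψ x ^ 2 ≤ ∫ x, ω₁ x * ‖gradient ψ x‖ ^ 2) :
    ∃ D : ℝ, ∀ S : ℝ, 1 ≤ S → R₀ ≤ S →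
      ∫ x in Metric.closedBall 0 1, ω₂ x * Real.exp (19 / 4 * u x) ≤ D / S := by
  obtain ⟨K, hK⟩ := exists_cutoff_family (E := EuclideanSpace ℝ (Fin N))
  have hM0 : 0 < M := (hω₂pos 0).trans_le (hM 0)
  set L := |K| + 1 with hL
  have hL0 : 0 < L := by positivity
  have hKL : K ≤ L ^ 2 := by nlinarith [le_abs_self K, abs_nonneg K]
  obtain ⟨e, he0, he⟩ : ∃ e : ℝ, 0 < e ∧ 10000 * C * e ^ 4 ≤ 1 / 2 := by
    have hB : 0 < 10000 * C := by positivity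
    refine ⟨1 / (2 * (10000 * C) + 1), by positivity, ?_⟩
    have h1 : (1 / (2 * (10000 * C) + 1)) ^ 4 ≤ 1 / (2 * (10000 * C) + 1) :=
      pow_le_of_le_one (by positivity) ((div_le_one (by positivity)).2 (by linarith))
        (by norm_num)
    calc _ ≤ 10000 * C * (1 / (2 * (10000 * C) + 1)) := by gcongr
      _ ≤ 1 / 2 := by
        rw [mul_one_div, div_le_div_iff₀ (by positivity) (by positivity)]
        linarith
  set v := (volume : Measure (EuclideanSpace ℝ (Fin N))).real (Metric.ball 0 1) with hv
  have hv0 : 0 ≤ v := measureReal_nonneg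
  refine ⟨2 * (10000 * C * M * (L ^ 19 / e ^ 15) * (512 * v)), fun S hS hSR => ?_⟩
  have hS0 : 0 < S := by positivity
  obtain ⟨η, hη, hηc, hη0, hη1, hηone, hgin, hgout, hgbd⟩ := hK (S ^ 2) (by positivity)
  have hηd : Differentiable ℝ η := hη.differentiable (by norm_num)
  have huc := hu.continuous
  have hηcont := hη.continuous
  have hω₁c := hω₁.continuous
  have hφ : ContDiff ℝ 2 (fun x => η x ^ 5) := by fun_prop
  have hφc : HasCompactSupport (fun x => η x ^ 5) :=
    hηc.comp_left (g := fun t : ℝ => t ^ 5) (by norm_num)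
  have henergy := stable_energy_estimate hω₁ hω₂ hω₁pos hu hsub hstab hφ hφc
  set X := ∫ x, ω₂ x * Real.exp (19 / 4 * u x) * (η x ^ 5) ^ 2 with hX
  have iX : Integrable (fun x => ω₂ x * Real.exp (19 / 4 * u x) * (η x ^ 5) ^ 2) :=
    Continuous.integrable_of_hasCompactSupport (by fun_prop)
      (hφc.comp_left (g := fun t : ℝ => t ^ 2) (by norm_num)).mul_left
  have hX0 : ∀ x, 0 ≤ ω₂ x * Real.exp (19 / 4 * u x) * (η x ^ 5) ^ 2 := fun x => by
    have := hω₂pos x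
    positivity
  set r := L / S with hr
  have hr0 : 0 ≤ r := by positivity
  set B := Metric.closedBall (0 : EuclideanSpace ℝ (Fin N)) (2 * S ^ 2) with hB
  have hBc : IsCompact B := isCompact_closedBall _ _
  have iB : Integrable (B.indicator fun _ => 25 * C * M * (r ^ 19 / e ^ 15)) :=
    (integrable_indicator_iff hBc.measurableSet).2
      (continuousOn_const.integrableOn_compact hBc)
  have hpoint : ∀ x, ω₁ x * Real.exp (15 / 4 * u x) * ‖gradient (fun x => η x ^ 5) x‖ ^ 2 ≤
      25 * C * e ^ 4 * (ω₂ x * Real.exp (19 / 4 * u x) * (η x ^ 5) ^ 2) +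
        B.indicator (fun _ => 25 * C * M * (r ^ 19 / e ^ 15)) x := by
    intro x
    rw [gradient_pow 5 (hηd x)]
    by_cases hx0 : gradient η x = 0
    · have h1 : 0 ≤ B.indicator (fun _ => 25 * C * M * (r ^ 19 / e ^ 15)) x :=
        Set.indicator_nonneg (fun _ _ => by positivity) x
      have h2 := hX0 x
      simp only [hx0, smul_zero, norm_zero]
      norm_num
      positivity
    · have hxl : S ^ 2 ≤ ‖x‖ := not_lt.1 fun h => hx0 (hgin x h)
      have hxu : ‖x‖ ≤ 2 * S ^ 2 := not_lt.1 fun h => hx0 (hgout x h)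
      have hxB : x ∈ B := by rwa [hB, mem_closedBall_zero_iff]
      rw [Set.indicator_of_mem hxB]
      have hω := hcomp x (by nlinarith)
      have hg : ‖gradient η x‖ ^ 2 ≤ r ^ 4 := by
        have : ‖gradient η x‖ ≤ r ^ 2 := by
          refine (hgbd x).trans ?_
          rw [hr, div_pow]
          gcongr
        calc ‖gradient η x‖ ^ 2 ≤ (r ^ 2) ^ 2 := by gcongr
          _ = r ^ 4 := by ring
      have habs := pointwise_absorption (Real.exp_pos (u x / 4)).le (hη0 x) (hη1 x) hr0 he0
      have e15 : Real.exp (15 / 4 * u x) = Real.exp (u x / 4) ^ 15 := by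
        rw [← Real.exp_nat_mul]; congr 1; push_cast; ring
      have e19 : Real.exp (19 / 4 * u x) = Real.exp (u x / 4) ^ 19 := by
        rw [← Real.exp_nat_mul]; congr 1; push_cast; ring
      rw [e15, e19, norm_smul, mul_pow, Real.norm_eq_abs, sq_abs]
      have hη0x := hη0 x
      have hω₂x := hω₂pos x
      calc ω₁ x * Real.exp (u x / 4) ^ 15 *
            (((5 : ℕ) * η x ^ (5 - 1)) ^ 2 * ‖gradient η x‖ ^ 2)
          ≤ C * ω₂ x * Real.exp (u x / 4) ^ 15 *
            (((5 : ℕ) * η x ^ (5 - 1)) ^ 2 * r ^ 4) := by gcongr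
        _ = 25 * C * ω₂ x * (Real.exp (u x / 4) ^ 15 * η x ^ 8 * r ^ 4) := by
          push_cast; ring
        _ ≤ 25 * C * ω₂ x * (e ^ 4 * (Real.exp (u x / 4) ^ 19 * η x ^ 10) + r ^ 19 / e ^ 15) := by
          gcongr
        _ = 25 * C * e ^ 4 * (ω₂ x * Real.exp (u x / 4) ^ 19 * (η x ^ 5) ^ 2) +
            25 * C * ω₂ x * (r ^ 19 / e ^ 15) := by ring
        _ ≤ _ := by
          gcongr
          exact hM x
  have hvol : ∫ x, B.indicator (fun _ => 25 * C * M * (r ^ 19 / e ^ 15)) x ≤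
      25 * C * M * (L ^ 19 / e ^ 15) * (512 * v) / S := by
    rw [integral_indicator hBc.measurableSet, setIntegral_const, hB,
      Measure.addHaar_real_closedBall _ _ (by positivity), finrank_euclideanSpace_fin, ← hv,
      smul_eq_mul]
    have h9 : (2 * S ^ 2) ^ N ≤ (2 * S ^ 2) ^ 9 :=
      pow_le_pow_right₀ (by nlinarith) hN9
    calc (2 * S ^ 2) ^ N * v * (25 * C * M * (r ^ 19 / e ^ 15))
        ≤ (2 * S ^ 2) ^ 9 * v * (25 * C * M * (r ^ 19 / e ^ 15)) := by gcongr
      _ = 25 * C * M * (L ^ 19 / e ^ 15) * (512 * v) / S := by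
        rw [hr]
        field_simp
        ring
  have hgrad : ∫ x, ω₁ x * Real.exp (15 / 4 * u x) * ‖gradient (fun x => η x ^ 5) x‖ ^ 2 ≤
      25 * C * e ^ 4 * X + 25 * C * M * (L ^ 19 / e ^ 15) * (512 * v) / S := by
    refine (integral_mono_of_nonneg (Eventually.of_forall fun x => ?_)
      ((iX.const_mul _).add iB) (Eventually.of_forall hpoint)).trans ?_
    · have := hω₁pos x
      simp only [Pi.zero_apply]
      positivity
    · refine (integral_add (iX.const_mul _) iB).trans_le ?_
      rw [integral_const_mul]
      gcongr
  have hXnn : 0 ≤ X := integral_nonneg hX0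
  have hXle : X ≤ 2 * (10000 * C * M * (L ^ 19 / e ^ 15) * (512 * v)) / S := by
    have h1 := mul_le_mul_of_nonneg_right he hXnn
    have h2 : 2 * (10000 * C * M * (L ^ 19 / e ^ 15) * (512 * v)) / S =
      800 * (25 * C * M * (L ^ 19 / e ^ 15) * (512 * v) / S) := by ring
    rw [h2]
    linarith
  refine le_trans ?_ hXle
  refine le_trans (le_of_eq (setIntegral_congr_fun measurableSet_closedBall fun x hx => ?_))
    (setIntegral_le_integral iX (Eventually.of_forall hX0))
  have hx1 : ‖x‖ ≤ S ^ 2 := (mem_closedBall_zero_iff.1 hx).trans (by nlinarith)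
  simp [hηone x hx1]

end Estimates

theorem stmt_9 (N : ℕ) (hN : 1 ≤ N) (hN9 : N ≤ 9)
    (ω₁ ω₂ : EuclideanSpace ℝ (Fin N) → ℝ)
    (hω₁ : ContDiff ℝ (⊤ : ℕ∞) ω₁) (hω₂ : ContDiff ℝ (⊤ : ℕ∞) ω₂)
    (hω₁pos : ∀ x, 0 < ω₁ x) (hω₂pos : ∀ x, 0 < ω₂ x)
    (hbdd : ∃ M : ℝ, ∀ x, ω₂ x ≤ M)
    (hcomp : ∃ C : ℝ, 0 < C ∧ ∃ R₀ : ℝ, ∀ x : EuclideanSpace ℝ (Fin N), R₀ ≤ ‖x‖ → ω₁ x ≤ C * ω₂ x)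
    (hmono : ∃ R₀ : ℝ, ∀ x : EuclideanSpace ℝ (Fin N), R₀ ≤ ‖x‖ → ⟪gradient ω₁ x, x⟫ ≤ 0) :
    ¬ ∃ u : EuclideanSpace ℝ (Fin N) → ℝ, ContDiff ℝ 2 u ∧
      (∀ x, -vdiv (fun y => ω₁ y • gradient u y) x ≤ ω₂ x * Real.exp (u x)) ∧
      (∀ ψ : EuclideanSpace ℝ (Fin N) → ℝ, ContDiff ℝ 2 ψ → HasCompactSupport ψ →
        ∫ x, ω₂ x * Real.exp (u x) * ψ x ^ 2 ≤ ∫ x, ω₁ x * ‖gradient ψ x‖ ^ 2) := by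
  rintro ⟨u, hu, hsub, hstab⟩
  obtain ⟨M, hM⟩ := hbdd
  obtain ⟨C, hC, R₀, hR₀⟩ := hcomp
  have two_le : ((2 : ℕ∞) : WithTop ℕ∞) ≤ ((⊤ : ℕ∞) : WithTop ℕ∞) := by exact_mod_cast le_top
  obtain ⟨D, hD⟩ := stable_integral_decay hN9 (hω₁.of_le two_le) hω₂.continuous hω₁pos hω₂pos
    hM hC hR₀ hu hsub hstab
  have huc := hu.continuous
  have hω₂c := hω₂.continuous
  have hpos := setIntegral_closedBall_pos (f := fun x => ω₂ x * Real.exp (19 / 4 * u x))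
    (by fun_prop) fun x => mul_pos (hω₂pos x) (Real.exp_pos _)
  have hlim : Tendsto (fun S : ℝ => D / S) atTop (nhds 0) := tendsto_const_nhds.div_atTop tendsto_id
  refine hpos.not_ge (ge_of_tendsto hlim ?_)
  filter_upwards [eventually_ge_atTop 1, eventually_ge_atTop R₀] with S h1 h2
  exact hD S h1 h2
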